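/- Let f = (1/2)·1_{[−1,1]} be the uniform density on [−1,1] and let π be a permutation of {1,…,n+1}. Then P(f,π) = 1/(2^n · n!) if and only if there exists i ∈ {1,…,n} such that {π(i), π(i+1)} = {1, n+1}. -/

import Mathlib

open MeasureTheory

noncomputable section

/-- Walk positions: `walk n x i = x 0 + ⋯ + x (i-1)` (so `walk n x 0 = 0`). -/
def walk (n : ℕ) (x : Fin n → ℝ) (i : Fin (n + 1)) : ℝ :=
  ∑ j : Fin n, if (j : ℕ) < (i : ℕ) then x j else 0

/-- The region of step tuples generating the ordinal pattern `π`. -/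
def D (n : ℕ) (π : Equiv.Perm (Fin (n + 1))) : Set (Fin n → ℝ) :=
  {x | (∀ i j : Fin (n + 1), i ≠ j → walk n x i ≠ walk n x j) ∧
       (∀ i j : Fin (n + 1), walk n x i < walk n x j ↔ π i < π j)}

/-- The matrix `L_π`. -/
def L (n : ℕ) (π : Equiv.Perm (Fin (n + 1))) : Matrix (Fin n) (Fin n) ℝ :=
  fun i j =>
    if (π i.castSucc : ℕ) ≤ (j : ℕ) ∧ (j : ℕ) < (π i.succ : ℕ) then 1
    else if (π i.succ : ℕ) ≤ (j : ℕ) ∧ (j : ℕ) < (π i.castSucc : ℕ) then -1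
    else 0

/-- Partial sum `x i + x (i+1) + ⋯ + x (j-1)`. -/
def psum (n : ℕ) (x : Fin n → ℝ) (i j : Fin (n + 1)) : ℝ :=
  ∑ k : Fin n, if (i : ℕ) ≤ (k : ℕ) ∧ (k : ℕ) < (j : ℕ) then x k else 0

/-- The level count `lev(π)_j`. -/
def lev (n : ℕ) (π : Equiv.Perm (Fin (n + 1))) (j : Fin n) : ℕ :=
  (Finset.univ.filter fun i : Fin n =>
    ((π i.castSucc : ℕ) ≤ (j : ℕ) ∧ (j : ℕ) < (π i.succ : ℕ)) ∨
    ((π i.succ : ℕ) ≤ (j : ℕ) ∧ (j : ℕ) < (π i.castSucc : ℕ))).card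

/-- The polytope of steps `P_π`. -/
def Ppoly (n : ℕ) (π : Equiv.Perm (Fin (n + 1))) : Set (Fin n → ℝ) :=
  {x | (∀ i, 0 ≤ x i) ∧ ∀ i : Fin n,
    psum n x (min (π i.castSucc) (π i.succ)) (max (π i.castSucc) (π i.succ)) ≤ 1}

/-- The set of positive roots, identified with pairs `i < j`. -/
def PosRoot (n : ℕ) := {p : Fin (n + 1) × Fin (n + 1) // p.1 < p.2}

/-- The Shi condition for an alcove address. -/
def Shi (n : ℕ) (k : PosRoot n → ℤ) : Prop :=
  ∀ (i t j : Fin (n + 1)) (hit : i < t) (htj : t < j),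
    k ⟨(i, t), hit⟩ + k ⟨(t, j), htj⟩ ≤ k ⟨(i, j), hit.trans htj⟩ ∧
    k ⟨(i, j), hit.trans htj⟩ ≤ k ⟨(i, t), hit⟩ + k ⟨(t, j), htj⟩ + 1

/-- The alcove with address `k`, in step coordinates. -/
def alcove (n : ℕ) (k : PosRoot n → ℤ) : Set (Fin n → ℝ) :=
  {x | ∀ p : PosRoot n,
    (k p : ℝ) < psum n x p.1.1 p.1.2 ∧ psum n x p.1.1 p.1.2 < (k p : ℝ) + 1}

/-- The root ideal `I_π`. -/
def rootIdeal (n : ℕ) (π : Equiv.Perm (Fin (n + 1))) : Set (PosRoot n) :=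
  {p | ∃ c : Fin n,
    min (π c.castSucc : ℕ) (π c.succ : ℕ) ≤ (p.1.1 : ℕ) ∧
    (p.1.2 : ℕ) ≤ max (π c.castSucc : ℕ) (π c.succ : ℕ)}

/-- The level count matrix `lev(π)_{i,j}`. -/
def lev2 (n : ℕ) (π : Equiv.Perm (Fin (n + 1))) (i j : Fin n) : ℕ :=
  (Finset.univ.filter fun k : Fin n =>
    ((π k.castSucc : ℕ) ≤ (i : ℕ) ∧ (π k.castSucc : ℕ) ≤ (j : ℕ) ∧
     (i : ℕ) < (π k.succ : ℕ) ∧ (j : ℕ) < (π k.succ : ℕ)) ∨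
    ((π k.succ : ℕ) ≤ (i : ℕ) ∧ (π k.succ : ℕ) ≤ (j : ℕ) ∧
     (i : ℕ) < (π k.castSucc : ℕ) ∧ (j : ℕ) < (π k.castSucc : ℕ))).card

theorem walk_zero (n : ℕ) (x : Fin n → ℝ) : walk n x 0 = 0 := by simp [walk]

theorem walk_last (n : ℕ) (x : Fin n → ℝ) : walk n x (Fin.last n) = ∑ j, x j := by
  simp [walk]

theorem walk_succ (n : ℕ) (x : Fin n → ℝ) (i : Fin n) :
    walk n x i.succ = walk n x i.castSucc + x i := by
  rw [← sub_eq_iff_eq_add', walk, walk, ← Finset.sum_sub_distrib,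
    Finset.sum_eq_single i (fun j _ hj => ?_) (by simp)]
  · simp
  · have : (j : ℕ) ≠ i := fun h => hj (Fin.ext h)
    simp only [Fin.val_succ, Fin.val_castSucc]
    split_ifs <;> first | omega | simp

theorem walk_const (n : ℕ) (c : ℝ) (i : Fin (n + 1)) : walk n (fun _ => c) i = i * c := by
  induction i using Fin.induction with
  | zero => simp [walk_zero]
  | succ i ih => rw [walk_succ, ih]; push_cast [Fin.val_succ, Fin.val_castSucc]; ring

theorem walk_add (n : ℕ) (x y : Fin n → ℝ) (i : Fin (n + 1)) :
    walk n (x + y) i = walk n x i + walk n y i := by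
  simp only [walk, ← Finset.sum_add_distrib, Pi.add_apply]
  exact Finset.sum_congr rfl fun j _ => by split_ifs <;> simp

theorem walk_smul (n : ℕ) (c : ℝ) (x : Fin n → ℝ) (i : Fin (n + 1)) :
    walk n (c • x) i = c * walk n x i := by
  simp [walk, Finset.mul_sum]

theorem continuous_walk (n : ℕ) (i : Fin (n + 1)) : Continuous fun x => walk n x i := by
  unfold walk
  refine continuous_finsetSum _ fun j _ => ?_
  split_ifs <;> fun_prop

theorem strictMono_walk_iff (n : ℕ) (x : Fin n → ℝ) :
    StrictMono (walk n x) ↔ ∀ i, 0 < x i := by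
  simp [Fin.strictMono_iff_lt_succ, walk_succ]

/-- The steps of the walk that visits the positions of the walk of `y` in the order `σ`. -/
def permStep (n : ℕ) (σ : Equiv.Perm (Fin (n + 1))) : (Fin n → ℝ) →ₗ[ℝ] (Fin n → ℝ) where
  toFun y i := walk n y (σ i.succ) - walk n y (σ i.castSucc)
  map_add' x y := by
    ext i
    simp only [walk_add, Pi.add_apply]
    ring
  map_smul' c x := by
    ext i
    simp only [walk_smul, Pi.smul_apply, smul_eq_mul, RingHom.id_apply]
    ring

theorem permStep_apply (n : ℕ) (σ : Equiv.Perm (Fin (n + 1))) (y : Fin n → ℝ) (i : Fin n) :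
    permStep n σ y i = walk n y (σ i.succ) - walk n y (σ i.castSucc) := rfl

theorem continuous_permStep_apply (n : ℕ) (σ : Equiv.Perm (Fin (n + 1))) (i : Fin n) :
    Continuous fun y => permStep n σ y i :=
  (continuous_walk n _).sub (continuous_walk n _)

theorem walk_permStep (n : ℕ) (σ : Equiv.Perm (Fin (n + 1))) (y : Fin n → ℝ)
    (i : Fin (n + 1)) :
    walk n (permStep n σ y) i = walk n y (σ i) - walk n y (σ 0) := by
  induction i using Fin.induction with
  | zero => simp [walk_zero]
  | succ i ih => rw [walk_succ, ih, permStep_apply]; ring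

theorem permStep_mul (n : ℕ) (σ τ : Equiv.Perm (Fin (n + 1))) :
    permStep n (τ * σ) = permStep n σ * permStep n τ := by
  ext1 y
  ext i
  simp [permStep_apply, walk_permStep]

theorem permStep_one (n : ℕ) : permStep n 1 = 1 := by
  ext1 y
  ext i
  simp [permStep_apply, walk_succ]

theorem permStep_pow (n : ℕ) (σ : Equiv.Perm (Fin (n + 1))) (k : ℕ) :
    permStep n (σ ^ k) = permStep n σ ^ k := by
  induction k with
  | zero => simp [permStep_one]
  | succ k ih => rw [pow_succ, permStep_mul, ih, pow_succ']

theorem abs_det_permStep (n : ℕ) (σ : Equiv.Perm (Fin (n + 1))) :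
    |LinearMap.det (permStep n σ)| = 1 := by
  refine (pow_eq_one_iff_of_nonneg (abs_nonneg _) (orderOf_pos σ).ne').1 ?_
  rw [← abs_pow, ← map_pow, ← permStep_pow, pow_orderOf_eq_one, permStep_one, map_one, abs_one]

theorem volume_preimage_permStep (n : ℕ) (σ : Equiv.Perm (Fin (n + 1)))
    (s : Set (Fin n → ℝ)) : volume (permStep n σ ⁻¹' s) = volume s := by
  have h := abs_det_permStep n σ
  rw [Measure.addHaar_preimage_linearMap volume
    (fun h0 => by simp [h0] at h), abs_inv, h]
  simp

theorem permStep_mem_D_iff (n : ℕ) (π : Equiv.Perm (Fin (n + 1))) (y : Fin n → ℝ) :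
    permStep n π y ∈ D n π ↔ ∀ i, 0 < y i := by
  rw [← strictMono_walk_iff]
  simp only [D, Set.mem_ofPred_eq, walk_permStep, sub_lt_sub_iff_right, ne_eq, sub_left_inj]
  refine ⟨fun h a b hab => ?_, fun h => ⟨fun i j hij => ?_, fun i j => h.lt_iff_lt⟩⟩
  · simpa using (h.2 (π.symm a) (π.symm b)).2 (by simpa using hab)
  · simpa [h.injective.eq_iff] using hij

theorem map_abs_volume_apply {s : Set ℝ} (hs : MeasurableSet s) :
    (volume : Measure ℝ).map abs s = 2 * volume (s ∩ Set.Ioi 0) := by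
  have hm : MeasurableSet (s ∩ Set.Ioi 0) := hs.inter measurableSet_Ioi
  rw [Measure.map_apply measurable_abs hs]
  have hae : (abs ⁻¹' s : Set ℝ) =ᵐ[volume]
      ((s ∩ Set.Ioi 0) ∪ Neg.neg ⁻¹' (s ∩ Set.Ioi 0) : Set ℝ) := by
    filter_upwards [Measure.ae_ne volume (0 : ℝ)] with x hx
    refine propext ?_
    change |x| ∈ s ↔ (x ∈ s ∧ 0 < x) ∨ (-x ∈ s ∧ 0 < -x)
    rcases hx.lt_or_gt with h | h
    · simp [abs_of_neg h, h, h.le]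
    · simp [abs_of_pos h, h, h.le]
  rw [measure_congr hae, measure_union _ (measurable_neg hm),
    (Measure.measurePreserving_neg (volume : Measure ℝ)).measure_preimage hm.nullMeasurableSet,
    two_mul]
  refine Set.disjoint_left.2 fun x hx hx' => ?_
  have h1 : 0 < x := hx.2
  have h2 : 0 < -x := hx'.2
  linarith

theorem map_abs_volume_pi (ι : Type*) [Fintype ι] :
    (volume : Measure (ι → ℝ)).map (fun x i => |x i|) =
      (2 : ENNReal) ^ Fintype.card ι • volume.restrict {x | ∀ i, 0 < x i} := by
  have : SigmaFinite ((volume : Measure ℝ).map abs) := by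
    refine ⟨⟨⟨fun k => Set.Iic k, fun _ => trivial, fun k => ?_, ?_⟩⟩⟩
    · rw [map_abs_volume_apply measurableSet_Iic, Set.inter_comm, Set.Ioi_inter_Iic]
      exact ENNReal.mul_lt_top (by simp) (by simp)
    · exact Set.eq_univ_of_forall fun x =>
        Set.mem_iUnion.2 ((exists_nat_ge x).imp fun _ h => h)
  have hset : {x : ι → ℝ | ∀ i, 0 < x i} = Set.univ.pi fun _ => Set.Ioi 0 := by
    ext; simp
  rw [volume_pi, Measure.pi_map_pi (fun _ => measurable_abs.aemeasurable)]
  refine Measure.pi_eq (μ := fun _ : ι => (volume : Measure ℝ).map abs) fun s hs => ?_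
  rw [Measure.smul_apply, Measure.restrict_apply (MeasurableSet.univ_pi hs), hset,
    ← Set.pi_inter_distrib, Measure.pi_pi]
  simp only [map_abs_volume_apply (hs _), Finset.prod_mul_distrib, Finset.prod_const,
    smul_eq_mul, Finset.card_univ]

theorem volume_pos_sum_le_one (n : ℕ) (hn : 1 ≤ n) :
    volume {x : Fin n → ℝ | (∀ i, 0 < x i) ∧ ∑ i, x i ≤ 1} =
      ENNReal.ofReal (1 / n.factorial) := by
  have : Nonempty (Fin n) := ⟨⟨0, hn⟩⟩
  have hball := MeasureTheory.volume_sum_rpow_le (Fin n) (p := 1) le_rfl 1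
  have hG : Real.Gamma (1 + 1) = 1 := by simpa using Real.Gamma_nat_eq_factorial 1
  simp only [Real.rpow_one, div_one, ENNReal.ofReal_one, one_pow, one_mul, Fintype.card_fin,
    Real.Gamma_nat_eq_factorial, hG, mul_one] at hball
  have hms : MeasurableSet {x : Fin n → ℝ | ∑ i, x i ≤ 1} :=
    measurableSet_le (by fun_prop) measurable_const
  have h := congrArg (fun μ => μ {x : Fin n → ℝ | ∑ i, x i ≤ 1}) (map_abs_volume_pi (Fin n))
  simp only [Measure.smul_apply, smul_eq_mul, Fintype.card_fin] at h
  rw [Measure.map_apply (by fun_prop) hms, Measure.restrict_apply hms, Set.preimage_ofPred_eq,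
    hball, div_eq_mul_one_div, ENNReal.ofReal_mul (by positivity),
    ENNReal.ofReal_pow (by norm_num), ENNReal.ofReal_ofNat] at h
  rw [ENNReal.mul_right_inj (by simp) (by simp)] at h
  rw [h]
  congr 1
  ext x
  exact and_comm

theorem pair_eq_zero_last_iff (n : ℕ) (a b : Fin (n + 1)) :
    ({a, b} : Set (Fin (n + 1))) = {0, Fin.last n} ↔
      (a = 0 ∧ b = Fin.last n) ∨ (a = Fin.last n ∧ b = 0) :=
  Set.pair_eq_pair_iff

theorem abs_walk_sub_walk_le (n : ℕ) (y : Fin n → ℝ) (hy : ∀ i, 0 < y i)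
    (a b : Fin (n + 1)) : |walk n y a - walk n y b| ≤ ∑ i, y i := by
  have hm := ((strictMono_walk_iff n y).2 hy).monotone
  have h (c : Fin (n + 1)) : 0 ≤ walk n y c ∧ walk n y c ≤ ∑ i, y i :=
    ⟨walk_zero n y ▸ hm (Fin.zero_le c), walk_last n y ▸ hm (Fin.le_last c)⟩
  rw [abs_le]
  constructor <;> linarith [h a, h b]

theorem abs_sub_le_of_pair_ne (n : ℕ) (a b : Fin (n + 1))
    (h : ({a, b} : Set (Fin (n + 1))) ≠ {0, Fin.last n}) :
    |(a : ℝ) - b| ≤ n - 1 := by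
  rw [ne_eq, pair_eq_zero_last_iff] at h
  simp only [Fin.ext_iff, Fin.val_zero, Fin.val_last] at h
  have h1 : (a : ℤ) - b ≤ n - 1 := by omega
  have h2 : (b : ℤ) - a ≤ n - 1 := by omega
  rw [abs_le]
  constructor
  · have : (b : ℝ) - a ≤ n - 1 := by exact_mod_cast h2
    linarith
  · exact_mod_cast h1

theorem setIntegral_uniform_eq (n : ℕ) (π : Equiv.Perm (Fin (n + 1))) :
    ∫ x in D n π, ∏ i : Fin n, (if -1 ≤ x i ∧ x i ≤ 1 then (1 : ℝ) / 2 else 0) =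
      volume.real {y : Fin n → ℝ | (∀ i, 0 < y i) ∧ ∀ i, |permStep n π y i| ≤ 1} / 2 ^ n := by
  have hcube : MeasurableSet {x : Fin n → ℝ | ∀ i, -1 ≤ x i ∧ x i ≤ 1} := by
    simp only [Set.ofPred_forall]
    measurability
  have hint (x : Fin n → ℝ) :
      ∏ i : Fin n, (if -1 ≤ x i ∧ x i ≤ 1 then (1 : ℝ) / 2 else 0) =
        {x : Fin n → ℝ | ∀ i, -1 ≤ x i ∧ x i ≤ 1}.indicator (fun _ => (1 / 2 : ℝ) ^ n) x := by
    rw [Fintype.prod_ite_zero, Set.indicator_apply]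
    simp
  simp only [hint]
  rw [setIntegral_indicator hcube, setIntegral_const, smul_eq_mul, measureReal_def,
    measureReal_def, ← volume_preimage_permStep n π, one_div_pow, mul_one_div]
  congr 4
  ext y
  simp only [Set.preimage_inter, Set.mem_inter_iff, Set.mem_preimage, permStep_mem_D_iff,
    Set.mem_ofPred_eq, abs_le]

/-- for the uniform density on `[-1,1]`, `P(f,π) = 1/(2^n n!)` iff the values
`1` and `n+1` occur in consecutive positions of `π`. -/
theorem stmt_17 (n : ℕ) (hn : 1 ≤ n) (π : Equiv.Perm (Fin (n + 1))) :
    (∫ x in D n π, ∏ i : Fin n, (if -1 ≤ x i ∧ x i ≤ 1 then (1 : ℝ) / 2 else 0)) =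
      1 / (2 ^ n * (n.factorial : ℝ)) ↔
    ∃ i : Fin n, ({π i.castSucc, π i.succ} : Set (Fin (n + 1))) = {0, Fin.last n} := by
  rw [setIntegral_uniform_eq, mul_comm, ← div_div, div_left_inj' (by positivity)]
  set Q := {y : Fin n → ℝ | (∀ i, 0 < y i) ∧ ∀ i, |permStep n π y i| ≤ 1}
  set S := {y : Fin n → ℝ | (∀ i, 0 < y i) ∧ ∑ i, y i ≤ 1}
  have hS : volume S = ENNReal.ofReal (1 / n.factorial) := volume_pos_sum_le_one n hn
  have hSQ : S ⊆ Q := fun y hy => ⟨hy.1, fun i => (abs_walk_sub_walk_le n y hy.1 _ _).trans hy.2⟩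
  constructor
  · intro hQ
    by_contra! hne
    set U := {y : Fin n → ℝ | (∀ i, 0 < y i) ∧ (∀ i, |permStep n π y i| < 1) ∧ 1 < ∑ i, y i}
    have hU : IsOpen U := by
      simp only [U, Set.ofPred_and, Set.ofPred_forall]
      refine (isOpen_iInter_of_finite fun i => ?_).inter
        ((isOpen_iInter_of_finite fun i => ?_).inter ?_)
      · exact isOpen_lt continuous_const (continuous_apply i)
      · exact isOpen_lt (continuous_permStep_apply n π i).abs continuous_const
      · exact isOpen_lt continuous_const (by fun_prop)
    have hn' : (0 : ℝ) < n := by exact_mod_cast hn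
    have hUne : U.Nonempty := by
      refine ⟨fun _ => (n + 1) / n ^ 2, fun i => by positivity, fun i => ?_, ?_⟩
      · have hi := abs_sub_le_of_pair_ne n (π i.succ) (π i.castSucc)
          (by rw [Set.pair_comm]; exact hne i)
        rw [permStep_apply, walk_const, walk_const, ← sub_mul, abs_mul,
          abs_of_pos (a := ((n : ℝ) + 1) / n ^ 2) (by positivity), ← mul_div_assoc,
          div_lt_one (by positivity)]
        nlinarith
      · rw [Finset.sum_const, Finset.card_univ, Fintype.card_fin, nsmul_eq_mul,
          ← mul_div_assoc, one_lt_div (by positivity)]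
        nlinarith
    have hdisj : Disjoint S U :=
      Set.disjoint_left.2 fun y hy hy' => not_lt.2 hy.2 hy'.2.2
    have hUQ : U ⊆ Q := fun y hy => ⟨hy.1, fun i => (hy.2.1 i).le⟩
    have hle : volume S + volume U ≤ volume Q := by
      rw [← measure_union hdisj hU.measurableSet]
      exact measure_mono (Set.union_subset hSQ hUQ)
    have hvQ : volume Q = ENNReal.ofReal (1 / n.factorial) := by
      rw [← hQ, measureReal_def, ENNReal.ofReal_toReal]
      intro htop
      rw [measureReal_def, htop, ENNReal.toReal_top] at hQ
      exact (by positivity : (0 : ℝ) < 1 / n.factorial).ne hQ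
    rw [hvQ, hS] at hle
    exact (ENNReal.lt_add_right ENNReal.ofReal_ne_top (hU.measure_pos volume hUne).ne').not_ge hle
  · rintro ⟨i, hi⟩
    have hQS : Q = S := by
      refine Set.Subset.antisymm (fun y hy => ⟨hy.1, ?_⟩) hSQ
      have h := hy.2 i
      rw [permStep_apply] at h
      rcases (pair_eq_zero_last_iff n _ _).1 hi with ⟨h1, h2⟩ | ⟨h1, h2⟩ <;>
        rw [h1, h2, walk_zero, walk_last] at h <;>
        linarith [abs_le.1 h]
    rw [hQS, measureReal_def, hS, ENNReal.toReal_ofReal (by positivity)]
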